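/- Let 0 < a < 1 and τ > 0, let u(z) = \sqrt{1-a^2} / (π (1-z) \sqrt{a^2 - z}), and define v(t) = u(t/τ) for t in the open interval (0, a^2 τ). Then for every t ∈ (0, a^2 τ), v satisfies 4 t (a^2 τ - t)(1 - t/τ) v''(t) + 2 ( 8t^2/τ - (5a^2 + 4) t + a^2 τ ) v'(t) + ( 9t/τ - 2a^2 - 1 ) v(t) = 0. -/

import Mathlib

/-- The function obtained from the Konno density by the substitution `z = x ^ 2`. -/
noncomputable def konnoHeunSolution (a : ℝ) : ℝ → ℝ :=
  fun z => Real.sqrt (1 - a ^ 2) / (Real.pi * (1 - z) * Real.sqrt (a ^ 2 - z))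

/-- The rescaled function `v(t) = u^{(d)}(t/τ)`. -/
noncomputable def rescaledKonnoHeunSolution (a τ : ℝ) : ℝ → ℝ :=
  fun t => konnoHeunSolution a (t / τ)

theorem hasDerivAt_konnoHeunSolution {a z : ℝ} (hz1 : z < 1) (hz : z < a ^ 2) :
    HasDerivAt (konnoHeunSolution a)
      (konnoHeunSolution a z * (1 / (1 - z) + 1 / (2 * (a ^ 2 - z)))) z := by
  have h1 : 1 - z ≠ 0 := (sub_pos.2 hz1).ne'
  have h2 : a ^ 2 - z ≠ 0 := (sub_pos.2 hz).ne'
  have hs : Real.sqrt (a ^ 2 - z) ≠ 0 := (Real.sqrt_pos.2 (sub_pos.2 hz)).ne'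
  have hsq : Real.sqrt (a ^ 2 - z) ^ 2 = a ^ 2 - z := Real.sq_sqrt (sub_pos.2 hz).le
  have hpi := Real.pi_ne_zero
  have hd := (((hasDerivAt_id z).const_sub 1).const_mul Real.pi).mul
    (((hasDerivAt_id z).const_sub (a ^ 2)).sqrt h2)
  have hu := (hasDerivAt_const z (Real.sqrt (1 - a ^ 2))).div hd
    (mul_ne_zero (mul_ne_zero hpi h1) hs)
  refine hu.congr_deriv ?_
  simp only [konnoHeunSolution, Pi.mul_apply, id]
  rw [← hsq, Real.sqrt_sq (Real.sqrt_nonneg _)]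
  field_simp
  ring

theorem hasDerivAt_rescaledKonnoHeunSolution {a τ t : ℝ} (hτ : 0 < τ) (ht1 : t < τ)
    (ht : t < a ^ 2 * τ) :
    HasDerivAt (rescaledKonnoHeunSolution a τ)
      (rescaledKonnoHeunSolution a τ t * (1 / (τ - t) + 1 / (2 * (a ^ 2 * τ - t)))) t := by
  have h1 : τ - t ≠ 0 := (sub_pos.2 ht1).ne'
  have h2 : a ^ 2 * τ - t ≠ 0 := (sub_pos.2 ht).ne'
  have hu := hasDerivAt_konnoHeunSolution (a := a) ((div_lt_one hτ).2 ht1) ((div_lt_iff₀ hτ).2 ht)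
  refine (hu.comp t ((hasDerivAt_id t).div_const τ)).congr_deriv ?_
  have e1 : 1 - t / τ = (τ - t) / τ := by field_simp
  have e2 : a ^ 2 - t / τ = (a ^ 2 * τ - t) / τ := by field_simp
  rw [rescaledKonnoHeunSolution, e1, e2]
  field_simp

/-- The rescaled Heun equation obtained by the substitution `z = t/τ`. -/
theorem rescaledKonnoHeunSolution_ode (a τ : ℝ) (ha0 : 0 < a) (ha1 : a < 1) (hτ : 0 < τ) :
    ∀ t ∈ Set.Ioo (0 : ℝ) (a ^ 2 * τ),
      4 * t * (a ^ 2 * τ - t) * (1 - t / τ)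
          * deriv (deriv (rescaledKonnoHeunSolution a τ)) t
        + 2 * (8 * t ^ 2 / τ - (5 * a ^ 2 + 4) * t + a ^ 2 * τ)
            * deriv (rescaledKonnoHeunSolution a τ) t
        + (9 * t / τ - 2 * a ^ 2 - 1) * rescaledKonnoHeunSolution a τ t = 0 := by
  intro t ht
  have hlt : a ^ 2 * τ < τ := by nlinarith [mul_pos (sub_pos.2 ha1) hτ]
  have hderiv : ∀ x < a ^ 2 * τ, HasDerivAt (rescaledKonnoHeunSolution a τ)
      (rescaledKonnoHeunSolution a τ x * (1 / (τ - x) + 1 / (2 * (a ^ 2 * τ - x)))) x :=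
    fun x hx => hasDerivAt_rescaledKonnoHeunSolution hτ (hx.trans hlt) hx
  have h1 : τ - t ≠ 0 := (sub_pos.2 (ht.2.trans hlt)).ne'
  have h2 : a ^ 2 * τ - t ≠ 0 := (sub_pos.2 ht.2).ne'
  have heq : deriv (rescaledKonnoHeunSolution a τ) =ᶠ[nhds t]
      fun x => rescaledKonnoHeunSolution a τ x * (1 / (τ - x) + 1 / (2 * (a ^ 2 * τ - x))) := by
    filter_upwards [Iio_mem_nhds ht.2] with x hx using (hderiv x hx).deriv
  have hL : HasDerivAt (fun x => 1 / (τ - x) + 1 / (2 * (a ^ 2 * τ - x)))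
      (1 / (τ - t) ^ 2 + 1 / (2 * (a ^ 2 * τ - t) ^ 2)) t := by
    refine (((hasDerivAt_const t (1 : ℝ)).div ((hasDerivAt_id t).const_sub τ) h1).add
      ((hasDerivAt_const t (1 : ℝ)).div (((hasDerivAt_id t).const_sub (a ^ 2 * τ)).const_mul 2)
        (mul_ne_zero two_ne_zero h2))).congr_deriv ?_
    simp only [id]
    field_simp
    ring
  rw [heq.deriv_eq, ((hderiv t ht.2).fun_mul hL).deriv, (hderiv t ht.2).deriv]
  field_simp
  ring
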